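/- Let a, b, c, p, x₀ ∈ ℝ³, let y(λ, μ) = (1 − λ) a + λ((1 − μ) b + μ c), assume y(λ, μ) ≠ p for all (λ, μ) ∈ [0,1]², and define v(λ, μ) = (y(λ, μ) − p)/‖y(λ, μ) − p‖ and x(λ, μ, σ) = y(λ, μ) + σ v(λ, μ). Let σ_max : [0,1]² → [0,∞) be continuous, let D = {(λ, μ, σ) : 0 ≤ λ ≤ 1, 0 ≤ μ ≤ 1, 0 ≤ σ ≤ σ_max(λ, μ)}, and suppose x is injective on the interior of D. Let s = x(D) be the image of D. Then for every continuous φ : [0,∞) → ℝ, ∫_s φ(‖x − x₀‖) dV = ∫₀¹ ∫₀¹ ∫₀^{σ_max(λ, μ)} φ(‖x(λ, μ, σ) − x₀‖) |J(λ, μ, σ)| dσ dλ dμ, where J(λ, μ, σ) = (1 + σ/‖y(λ, μ) − p‖)² · λ · [v(λ, μ) · ((b − a) × (c − b))]. -/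

import Mathlib

open MeasureTheory
open scoped RealInnerProductSpace

/-- The vector cross product on `EuclideanSpace ℝ (Fin 3)`. -/
noncomputable def cross3 (u v : EuclideanSpace ℝ (Fin 3)) : EuclideanSpace ℝ (Fin 3) :=
  (WithLp.equiv 2 (Fin 3 → ℝ)).symm
    (crossProduct ((WithLp.equiv 2 (Fin 3 → ℝ)) u) ((WithLp.equiv 2 (Fin 3 → ℝ)) v))

open Set

/-- The coordinates of a point of Euclidean 3-space, as an iterated pair. -/
def coordsThree (w : EuclideanSpace ℝ (Fin 3)) : ℝ × ℝ × ℝ := (w 0, w 1, w 2)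

theorem measurePreserving_coordsThree : MeasurePreserving coordsThree volume volume := by
  have h1 := EuclideanSpace.volume_preserving_symm_measurableEquiv_toLp (Fin 3)
  have h2 := volume_preserving_piFinSuccAbove (fun _ : Fin 3 => ℝ) 0
  have h3 := (MeasurePreserving.id (volume : Measure ℝ)).prod (volume_preserving_finTwoArrow ℝ)
  exact h3.comp (h2.comp h1)

theorem bijective_coordsThree : Function.Bijective coordsThree := by
  refine ⟨fun u w h => ?_, fun r => ⟨!₂[r.1, r.2.1, r.2.2], rfl⟩⟩
  simp only [coordsThree, Prod.mk.injEq] at h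
  ext i
  fin_cases i
  exacts [h.1, h.2.1, h.2.2]

theorem continuous_coordsThree : Continuous coordsThree := by
  unfold coordsThree
  fun_prop

/-- The determinant of an endomorphism of Euclidean 3-space is the triple product of the images of
the coordinate vectors. -/
theorem det_eq_inner_cross3 (L : EuclideanSpace ℝ (Fin 3) →L[ℝ] EuclideanSpace ℝ (Fin 3)) :
    L.det = ⟪L (EuclideanSpace.single 2 1), cross3 (L (EuclideanSpace.single 0 1))
      (L (EuclideanSpace.single 1 1))⟫ := by
  rw [ContinuousLinearMap.det, ← LinearMap.det_toMatrix (EuclideanSpace.basisFun (Fin 3) ℝ).toBasis,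
    Matrix.det_fin_three]
  simp [LinearMap.toMatrix_apply, cross3, PiLp.inner_apply, Fin.sum_univ_three, crossProduct]
  ring

/-- The closed region below the graph of `S` over the unit square, in coordinates `(λ, μ, σ)`. -/
def closedSubgraph (S : ℝ → ℝ → ℝ) : Set (ℝ × ℝ × ℝ) :=
  {r | r.1 ∈ Icc (0 : ℝ) 1 ∧ r.2.1 ∈ Icc (0 : ℝ) 1 ∧ r.2.2 ∈ Icc (0 : ℝ) (S r.1 r.2.1)}

/-- The open region below the graph of `S` over the unit square, in coordinates `(λ, μ, σ)`. -/
def openSubgraph (S : ℝ → ℝ → ℝ) : Set (ℝ × ℝ × ℝ) :=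
  {r | r.1 ∈ Ioo (0 : ℝ) 1 ∧ r.2.1 ∈ Ioo (0 : ℝ) 1 ∧ r.2.2 ∈ Ioo (0 : ℝ) (S r.1 r.2.1)}

theorem openSubgraph_subset_closedSubgraph (S : ℝ → ℝ → ℝ) :
    openSubgraph S ⊆ closedSubgraph S :=
  fun _ hr => ⟨Ioo_subset_Icc_self hr.1, Ioo_subset_Icc_self hr.2.1, Ioo_subset_Icc_self hr.2.2⟩

section Subgraph

variable {S : ℝ → ℝ → ℝ}

theorem isOpen_openSubgraph (hS : Continuous fun r : ℝ × ℝ => S r.1 r.2) :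
    IsOpen (openSubgraph S) := by
  have h : Continuous fun r : ℝ × ℝ × ℝ => S r.1 r.2.1 :=
    hS.comp (f := fun r : ℝ × ℝ × ℝ => (r.1, r.2.1)) (by fun_prop)
  refine (isOpen_Ioo.preimage continuous_fst).inter ((isOpen_Ioo.preimage
    (continuous_fst.comp continuous_snd)).inter ?_)
  exact (isOpen_lt continuous_const (continuous_snd.comp continuous_snd)).inter
    (isOpen_lt (continuous_snd.comp continuous_snd) h)

theorem isCompact_closedSubgraph (hS : Continuous fun r : ℝ × ℝ => S r.1 r.2) :
    IsCompact (closedSubgraph S) := by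
  have h : Continuous fun r : ℝ × ℝ × ℝ => S r.1 r.2.1 :=
    hS.comp (f := fun r : ℝ × ℝ × ℝ => (r.1, r.2.1)) (by fun_prop)
  have hclosed : IsClosed (closedSubgraph S) := by
    refine (isClosed_Icc.preimage continuous_fst).inter ((isClosed_Icc.preimage
      (continuous_fst.comp continuous_snd)).inter ?_)
    exact (isClosed_le continuous_const (continuous_snd.comp continuous_snd)).inter
      (isClosed_le (continuous_snd.comp continuous_snd) h)
  obtain ⟨M, hM⟩ := ((isCompact_Icc (a := (0 : ℝ)) (b := 1)).prod
    (isCompact_Icc (a := (0 : ℝ)) (b := 1))).bddAbove_image hS.continuousOn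
  refine (isCompact_Icc.prod (isCompact_Icc.prod isCompact_Icc)).of_isClosed_subset
    (t := closedSubgraph S) (s := Icc (0 : ℝ) 1 ×ˢ Icc (0 : ℝ) 1 ×ˢ Icc (0 : ℝ) M) hclosed ?_
  exact fun r hr => ⟨hr.1, hr.2.1, hr.2.2.1, hr.2.2.2.trans
    (hM (mem_image_of_mem (fun r : ℝ × ℝ => S r.1 r.2) (mk_mem_prod hr.1 hr.2.1)))⟩

theorem volume_closedSubgraph_diff_openSubgraph
    (hS : Continuous fun r : ℝ × ℝ => S r.1 r.2) :
    volume (closedSubgraph S \ openSubgraph S) = 0 := by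
  have hm : MeasurableSet (closedSubgraph S \ openSubgraph S) :=
    (isCompact_closedSubgraph hS).measurableSet.diff (isOpen_openSubgraph hS).measurableSet
  have hae : ∀ᵐ t : ℝ, t ≠ 0 ∧ t ≠ 1 := by
    filter_upwards [Measure.ae_ne volume (0 : ℝ), Measure.ae_ne volume (1 : ℝ)] with t h0 h1
      using ⟨h0, h1⟩
  rw [Measure.volume_eq_prod, Measure.measure_prod_null hm]
  filter_upwards [hae] with l hl
  rw [Measure.volume_eq_prod, Pi.zero_apply,
    Measure.measure_prod_null (hm.preimage measurable_prodMk_left)]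
  filter_upwards [hae] with m hm
  refine measure_mono_null (t := {0, S l m}) ?_ ((toFinite _).measure_zero _)
  rintro t ⟨⟨h1, h2, h3⟩, hn⟩
  by_contra hc
  simp only [mem_insert_iff, mem_singleton_iff, not_or] at hc
  exact hn ⟨⟨h1.1.lt_of_ne' hl.1, h1.2.lt_of_ne hl.2⟩, ⟨h2.1.lt_of_ne' hm.1, h2.2.lt_of_ne hm.2⟩,
    h3.1.lt_of_ne' hc.1, h3.2.lt_of_ne hc.2⟩

theorem setIntegral_closedSubgraph (hS : Continuous fun r : ℝ × ℝ => S r.1 r.2)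
    {F : ℝ × ℝ × ℝ → ℝ} (hF : ContinuousOn F (closedSubgraph S)) :
    ∫ r in closedSubgraph S, F r =
      ∫ m in Icc (0 : ℝ) 1, ∫ l in Icc (0 : ℝ) 1, ∫ t in Icc (0 : ℝ) (S l m), F (l, m, t) := by
  have hm := (isCompact_closedSubgraph hS).measurableSet
  have hF_int : Integrable ((closedSubgraph S).indicator F) :=
    (integrable_indicator_iff hm).2 (hF.integrableOn_compact (isCompact_closedSubgraph hS))
  let T : (ℝ × ℝ) × ℝ ≃ᵐ ℝ × ℝ × ℝ :=
    (MeasurableEquiv.prodCongr MeasurableEquiv.prodComm (MeasurableEquiv.refl ℝ)).trans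
      MeasurableEquiv.prodAssoc
  have hT : MeasurePreserving T volume volume :=
    volume_preserving_prodAssoc.comp
      (Measure.measurePreserving_swap.prod (MeasurePreserving.id volume))
  have hFT_int := (hT.integrable_comp_emb T.measurableEmbedding).2 hF_int
  rw [← integral_indicator hm, ← hT.integral_comp T.measurableEmbedding,
    Measure.volume_eq_prod]
  refine (integral_prod _ hFT_int).trans ?_
  rw [Measure.volume_eq_prod,
    integral_prod _ hFT_int.integral_prod_left, ← integral_indicator measurableSet_Icc]
  congr 1 with m
  by_cases hmu : m ∈ Icc (0 : ℝ) 1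
  · rw [indicator_of_mem hmu, ← integral_indicator measurableSet_Icc]
    congr 1 with l
    by_cases hl : l ∈ Icc (0 : ℝ) 1
    · rw [indicator_of_mem hl, ← integral_indicator measurableSet_Icc]
      congr 1 with t
      by_cases ht : t ∈ Icc (0 : ℝ) (S l m)
      · rw [indicator_of_mem ht]
        exact indicator_of_mem (show (l, m, t) ∈ closedSubgraph S from ⟨hl, hmu, ht⟩) F
      · rw [indicator_of_notMem ht]
        exact indicator_of_notMem (show (l, m, t) ∉ closedSubgraph S from fun h => ht h.2.2) F
    · rw [indicator_of_notMem hl, ← integral_zero ℝ ℝ]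
      congr 1 with t
      exact indicator_of_notMem (show (l, m, t) ∉ closedSubgraph S from fun h => hl h.1) F
  · rw [indicator_of_notMem hmu, ← integral_zero ℝ ℝ]
    congr 1 with l
    rw [← integral_zero ℝ ℝ]
    congr 1 with t
    exact indicator_of_notMem (show (l, m, t) ∉ closedSubgraph S from fun h => hmu h.2.1) F

end Subgraph

theorem inner_cross3_shear (q e d : EuclideanSpace ℝ (Fin 3)) (N k l m α β : ℝ) :
    ⟪N • q, cross3 (k • (e + m • d) + α • q) (k • l • d + β • q)⟫ =
      k ^ 2 * l * ⟪N • q, cross3 e d⟫ := by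
  simp [cross3, PiLp.inner_apply, Fin.sum_univ_three, crossProduct]
  ring

/-- The point of the triangle `a b c` with coordinates `(w 0, w 1)`. -/
noncomputable def trianglePoint (a b c w : EuclideanSpace ℝ (Fin 3)) : EuclideanSpace ℝ (Fin 3) :=
  (1 - w 0) • a + w 0 • ((1 - w 1) • b + w 1 • c)

/-- The point at distance `w 2` from `trianglePoint a b c w`, in the direction away from `p`. -/
noncomputable def sliverMap (a b c p w : EuclideanSpace ℝ (Fin 3)) : EuclideanSpace ℝ (Fin 3) :=
  trianglePoint a b c w +
    w 2 • (‖trianglePoint a b c w - p‖⁻¹ • (trianglePoint a b c w - p))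

theorem exists_hasFDerivAt_trianglePoint (a b c w : EuclideanSpace ℝ (Fin 3)) :
    ∃ L : EuclideanSpace ℝ (Fin 3) →L[ℝ] EuclideanSpace ℝ (Fin 3),
      HasFDerivAt (trianglePoint a b c) L w ∧
      L (EuclideanSpace.single 0 1) = (b - a) + w 1 • (c - b) ∧
      L (EuclideanSpace.single 1 1) = w 0 • (c - b) ∧
      L (EuclideanSpace.single 2 1) = 0 := by
  have h0 : HasFDerivAt (fun w : EuclideanSpace ℝ (Fin 3) => w 0)
      (EuclideanSpace.proj 0 : EuclideanSpace ℝ (Fin 3) →L[ℝ] ℝ) w :=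
    (EuclideanSpace.proj 0 : EuclideanSpace ℝ (Fin 3) →L[ℝ] ℝ).hasFDerivAt
  have h1 : HasFDerivAt (fun w : EuclideanSpace ℝ (Fin 3) => w 1)
      (EuclideanSpace.proj 1 : EuclideanSpace ℝ (Fin 3) →L[ℝ] ℝ) w :=
    (EuclideanSpace.proj 1 : EuclideanSpace ℝ (Fin 3) →L[ℝ] ℝ).hasFDerivAt
  refine ⟨_, ((h0.const_sub 1).smul_const a).add
    (h0.smul (((h1.const_sub 1).smul_const b).add (h1.smul_const c))), ?_, ?_, ?_⟩
  · simp
    module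
  · simp
    module
  · simp

theorem exists_hasFDerivAt_sliverMap {a b c p w : EuclideanSpace ℝ (Fin 3)}
    (hw : trianglePoint a b c w ≠ p) :
    ∃ L : EuclideanSpace ℝ (Fin 3) →L[ℝ] EuclideanSpace ℝ (Fin 3),
      HasFDerivAt (sliverMap a b c p) L w ∧
      L.det = (1 + w 2 / ‖trianglePoint a b c w - p‖) ^ 2 * w 0 *
        ⟪‖trianglePoint a b c w - p‖⁻¹ • (trianglePoint a b c w - p),
          cross3 (b - a) (c - b)⟫ := by
  obtain ⟨Y', hY, hY0, hY1, hY2⟩ := exists_hasFDerivAt_trianglePoint a b c w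
  have h2 : HasFDerivAt (fun w : EuclideanSpace ℝ (Fin 3) => w 2)
      (EuclideanSpace.proj 2 : EuclideanSpace ℝ (Fin 3) →L[ℝ] ℝ) w :=
    (EuclideanSpace.proj 2 : EuclideanSpace ℝ (Fin 3) →L[ℝ] ℝ).hasFDerivAt
  have hne : trianglePoint a b c w - p ≠ 0 := sub_ne_zero.2 hw
  have hg : DifferentiableAt ℝ (fun q : EuclideanSpace ℝ (Fin 3) => ‖q - p‖⁻¹)
      (trianglePoint a b c w) :=
    ((differentiableAt_id.sub_const p).norm ℝ hne).inv (norm_ne_zero_iff.2 hne)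
  have hN := hg.hasFDerivAt.comp w hY
  refine ⟨_, hY.add (h2.smul (hN.smul (hY.sub_const p))), ?_⟩
  rw [det_eq_inner_cross3]
  set G := fderiv ℝ (fun q : EuclideanSpace ℝ (Fin 3) => ‖q - p‖⁻¹) (trianglePoint a b c w)
  set q := trianglePoint a b c w - p
  have h := inner_cross3_shear q (b - a) (c - b) ‖q‖⁻¹ (1 + w 2 / ‖q‖) (w 0) (w 1)
    (w 2 * G ((b - a) + w 1 • (c - b))) (w 2 * G (w 0 • (c - b)))
  rw [← h]
  congr 1
  · simp [hY2, q]
  · congr 1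
    · simp [hY0, q]
      module
    · simp [hY1, q]
      module

theorem setIntegral_image_sliverMap {a b c p : EuclideanSpace ℝ (Fin 3)} {S : ℝ → ℝ → ℝ}
    (hS : Continuous fun r : ℝ × ℝ => S r.1 r.2)
    (hp : ∀ w, coordsThree w ∈ closedSubgraph S → trianglePoint a b c w ≠ p)
    (hinj : InjOn (sliverMap a b c p) (coordsThree ⁻¹' openSubgraph S))
    (g : EuclideanSpace ℝ (Fin 3) → ℝ) :
    ∫ z in sliverMap a b c p '' (coordsThree ⁻¹' closedSubgraph S), g z =
      ∫ w in coordsThree ⁻¹' closedSubgraph S, g (sliverMap a b c p w) *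
        |(1 + w 2 / ‖trianglePoint a b c w - p‖) ^ 2 * w 0 *
          ⟪‖trianglePoint a b c w - p‖⁻¹ • (trianglePoint a b c w - p),
            cross3 (b - a) (c - b)⟫| := by
  have hsub := preimage_mono (f := coordsThree) (openSubgraph_subset_closedSubgraph S)
  have hmeas : MeasurableSet (coordsThree ⁻¹' openSubgraph S) :=
    (isOpen_openSubgraph hS).measurableSet.preimage measurePreserving_coordsThree.measurable
  have hnull : volume (coordsThree ⁻¹' closedSubgraph S \ coordsThree ⁻¹' openSubgraph S) = 0 :=
    measurePreserving_coordsThree.quasiMeasurePreserving.preimage_null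
      (volume_closedSubgraph_diff_openSubgraph hS)
  have hdiff : DifferentiableOn ℝ (sliverMap a b c p)
      (coordsThree ⁻¹' closedSubgraph S \ coordsThree ⁻¹' openSubgraph S) := fun w hw =>
    let ⟨_, hL, _⟩ := exists_hasFDerivAt_sliverMap (hp w hw.1)
    hL.differentiableAt.differentiableWithinAt
  have hnull_image : volume (sliverMap a b c p '' (coordsThree ⁻¹' closedSubgraph S) \
      sliverMap a b c p '' (coordsThree ⁻¹' openSubgraph S)) = 0 :=
    measure_mono_null (sdiff_subset_iff.2 (by
      rw [← image_union, union_sdiff_self]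
      exact image_mono subset_union_right))
      (addHaar_image_eq_zero_of_differentiableOn_of_addHaar_eq_zero volume hdiff hnull)
  have hae {s t : Set (EuclideanSpace ℝ (Fin 3))} (hst : t ⊆ s) (h : volume (s \ t) = 0) :
      s =ᵐ[volume] t :=
    (ae_le_set.2 h).antisymm hst.eventuallyLE
  rw [setIntegral_congr_set (hae (image_mono hsub) hnull_image),
    setIntegral_congr_set (hae hsub hnull),
    integral_image_eq_integral_abs_det_fderiv_smul volume hmeas
      (f' := fderiv ℝ (sliverMap a b c p)) (fun w hw => ?_) hinj]
  · refine setIntegral_congr_fun hmeas fun w hw => ?_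
    obtain ⟨L, hL, hdet⟩ := exists_hasFDerivAt_sliverMap (hp w (hsub hw))
    simp only [hL.fderiv, hdet, smul_eq_mul, mul_comm]
  · obtain ⟨L, hL, -⟩ := exists_hasFDerivAt_sliverMap (hp w (hsub hw))
    exact hL.differentiableAt.hasFDerivAt.hasFDerivWithinAt

/-- **Change of variables for the integral over a sliver of volume.**
With `y(λ, μ) = (1 − λ) a + λ((1 − μ) b + μ c)`, `v(λ, μ) = (y(λ, μ) − p)/‖y(λ, μ) − p‖`,
`x(λ, μ, σ) = y(λ, μ) + σ v(λ, μ)`, a continuous `σ_max ≥ 0` on `[0,1]²`,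
`D = {(λ, μ, σ) : 0 ≤ λ ≤ 1, 0 ≤ μ ≤ 1, 0 ≤ σ ≤ σ_max(λ, μ)}`, `x` injective on the
interior of `D`, and `s = x(D)`, for every continuous `φ : [0,∞) → ℝ`,
`∫_s φ(‖x − x₀‖) dV = ∫₀¹∫₀¹∫₀^{σ_max(λ,μ)} φ(‖x(λ,μ,σ) − x₀‖)|J(λ,μ,σ)| dσ dλ dμ` with
`J(λ, μ, σ) = (1 + σ/‖y(λ, μ) − p‖)² λ [v(λ, μ) · ((b − a) × (c − b))]`. -/
theorem integral_sliver_change_of_variables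
    (a b c p x₀ : EuclideanSpace ℝ (Fin 3))
    (y : ℝ → ℝ → EuclideanSpace ℝ (Fin 3))
    (hy : ∀ lam mu : ℝ, y lam mu = (1 - lam) • a + lam • ((1 - mu) • b + mu • c))
    (hyp : ∀ lam ∈ Set.Icc (0:ℝ) 1, ∀ mu ∈ Set.Icc (0:ℝ) 1, y lam mu ≠ p)
    (v : ℝ → ℝ → EuclideanSpace ℝ (Fin 3))
    (hv : ∀ lam mu : ℝ, v lam mu = ‖y lam mu - p‖⁻¹ • (y lam mu - p))
    (x : ℝ × ℝ × ℝ → EuclideanSpace ℝ (Fin 3))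
    (hx : ∀ r : ℝ × ℝ × ℝ, x r = y r.1 r.2.1 + r.2.2 • v r.1 r.2.1)
    (σmax : ℝ → ℝ → ℝ)
    (hσnn : ∀ lam ∈ Set.Icc (0:ℝ) 1, ∀ mu ∈ Set.Icc (0:ℝ) 1, 0 ≤ σmax lam mu)
    (hσcont : ContinuousOn (fun r : ℝ × ℝ => σmax r.1 r.2)
      (Set.Icc (0:ℝ) 1 ×ˢ Set.Icc (0:ℝ) 1))
    (D : Set (ℝ × ℝ × ℝ))
    (hD : D = {r : ℝ × ℝ × ℝ | r.1 ∈ Set.Icc (0:ℝ) 1 ∧ r.2.1 ∈ Set.Icc (0:ℝ) 1 ∧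
      r.2.2 ∈ Set.Icc (0:ℝ) (σmax r.1 r.2.1)})
    (hinj : Set.InjOn x (interior D))
    (s : Set (EuclideanSpace ℝ (Fin 3))) (hs : s = x '' D)
    (J : ℝ → ℝ → ℝ → ℝ)
    (hJ : ∀ lam mu σ : ℝ, J lam mu σ =
      (1 + σ / ‖y lam mu - p‖) ^ 2 * lam * ⟪v lam mu, cross3 (b - a) (c - b)⟫)
    (φ : ℝ → ℝ) (hφ : ContinuousOn φ (Set.Ici 0)) :
    ∫ z in s, φ ‖z - x₀‖ =
      ∫ mu in Set.Icc (0:ℝ) 1, ∫ lam in Set.Icc (0:ℝ) 1,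
        ∫ σ in Set.Icc (0:ℝ) (σmax lam mu),
          φ ‖x (lam, mu, σ) - x₀‖ * |J lam mu σ| := by
  let clamp : ℝ → ℝ := fun t => max 0 (min 1 t)
  have hclamp (t : ℝ) : clamp t ∈ Icc (0 : ℝ) 1 :=
    ⟨le_max_left _ _, max_le zero_le_one (min_le_left _ _)⟩
  have hclamp_eq {t : ℝ} (ht : t ∈ Icc (0 : ℝ) 1) : clamp t = t := by
    simp only [clamp, min_eq_right ht.2, max_eq_right ht.1]
  let S : ℝ → ℝ → ℝ := fun l m => σmax (clamp l) (clamp m)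
  have hS : Continuous fun r : ℝ × ℝ => S r.1 r.2 :=
    hσcont.comp_continuous (f := fun r : ℝ × ℝ => (clamp r.1, clamp r.2)) (by fun_prop)
      fun r => ⟨hclamp r.1, hclamp r.2⟩
  have hDS : D = closedSubgraph S := by
    rw [hD]
    ext r
    refine and_congr_right fun h1 => and_congr_right fun h2 => ?_
    simp only [S, hclamp_eq h1, hclamp_eq h2]
  have hxw (w : EuclideanSpace ℝ (Fin 3)) : x (coordsThree w) = sliverMap a b c p w := by
    simp only [hx, hv, hy, coordsThree, sliverMap, trianglePoint]
  have hsw : s = sliverMap a b c p '' (coordsThree ⁻¹' closedSubgraph S) := by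
    rw [hs, hDS, ← funext hxw, ← image_preimage_eq (closedSubgraph S)
      bijective_coordsThree.surjective, image_image,
      preimage_image_eq _ bijective_coordsThree.injective]
  have hopen : openSubgraph S ⊆ interior D :=
    interior_maximal (hDS ▸ openSubgraph_subset_closedSubgraph S) (isOpen_openSubgraph hS)
  have hinjw : InjOn (sliverMap a b c p) (coordsThree ⁻¹' openSubgraph S) :=
    fun u hu w hw h => bijective_coordsThree.injective
      (hinj (hopen hu) (hopen hw) (by rw [hxw, hxw, h]))
  have hpw (w : EuclideanSpace ℝ (Fin 3)) (hw : coordsThree w ∈ closedSubgraph S) :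
      trianglePoint a b c w ≠ p := by
    have := hyp _ hw.1 _ hw.2.1
    rwa [hy] at this
  have hycont : Continuous fun r : ℝ × ℝ × ℝ => y r.1 r.2.1 := by
    simp only [hy]
    fun_prop
  have hvcont : ContinuousOn (fun r : ℝ × ℝ × ℝ => v r.1 r.2.1) (closedSubgraph S) := by
    simp only [hv]
    exact ((hycont.sub continuous_const).norm.continuousOn.inv₀ fun r hr =>
      norm_ne_zero_iff.2 (sub_ne_zero.2 (hyp _ hr.1 _ hr.2.1))).smul
        (hycont.sub continuous_const).continuousOn
  have hxcont : ContinuousOn x (closedSubgraph S) := by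
    rw [funext hx]
    exact hycont.continuousOn.add ((continuous_snd.comp continuous_snd).continuousOn.smul hvcont)
  have hJcont : ContinuousOn (fun r : ℝ × ℝ × ℝ => J r.1 r.2.1 r.2.2) (closedSubgraph S) := by
    simp only [hJ]
    refine ContinuousOn.mul (ContinuousOn.mul (ContinuousOn.pow (continuousOn_const.add
      (ContinuousOn.div (by fun_prop) (hycont.sub continuous_const).norm.continuousOn
        fun r hr => norm_ne_zero_iff.2 (sub_ne_zero.2 (hyp _ hr.1 _ hr.2.1)))) 2)
          continuous_fst.continuousOn) (hvcont.inner continuousOn_const)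
  have hF : ContinuousOn (fun r : ℝ × ℝ × ℝ => φ ‖x r - x₀‖ * |J r.1 r.2.1 r.2.2|)
      (closedSubgraph S) :=
    (hφ.comp (hxcont.sub continuousOn_const).norm fun r _ => norm_nonneg _).mul hJcont.abs
  have hemb : MeasurableEmbedding coordsThree :=
    continuous_coordsThree.measurableEmbedding bijective_coordsThree.injective
  calc ∫ z in s, φ ‖z - x₀‖
    _ = ∫ w in coordsThree ⁻¹' closedSubgraph S,
          φ ‖x (coordsThree w) - x₀‖ *
            |J (coordsThree w).1 (coordsThree w).2.1 (coordsThree w).2.2| := by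
      rw [hsw, setIntegral_image_sliverMap hS hpw hinjw]
      simp only [hxw]
      simp only [hJ, hv, hy, coordsThree, trianglePoint]
    _ = ∫ r in closedSubgraph S, φ ‖x r - x₀‖ * |J r.1 r.2.1 r.2.2| :=
      measurePreserving_coordsThree.setIntegral_preimage_emb hemb
        (fun r => φ ‖x r - x₀‖ * |J r.1 r.2.1 r.2.2|) _
    _ = _ := by
      rw [setIntegral_closedSubgraph hS hF]
      refine setIntegral_congr_fun measurableSet_Icc fun m hm => ?_
      refine setIntegral_congr_fun measurableSet_Icc fun l hl => ?_
      simp only [S, hclamp_eq hm, hclamp_eq hl]
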